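/- arXiv:1405.3271 — 3 statements merged into one kernel-verified Lean document; each statement's English description precedes it below -/
import Mathlib

section
/- Let n ≥ 2, δ > 0, and let G be a bipartite δ-expander graph of maximum degree d on 2n vertices admitting a perfect matching. Then for every edge e of G, the probability p(e) that a uniformly chosen random perfect matching contains e satisfies p(e) ≥ (1/d)·n^{-2·ln(d-1)/ln(1+δ)}. -/
/-- A bipartite graph (edge relation `E : U → V → Prop`) is a `δ`-expander if every
subset of either side of size at most half that side expands by a factor `1+δ`. -/
def IsBipartiteExpander {U V : Type*} [Fintype U] [Fintype V] (E : U → V → Prop)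
    (δ : ℝ) : Prop :=
  (∀ S : Set U, (S.ncard : ℝ) ≤ (Fintype.card U : ℝ) / 2 →
    (1 + δ) * (S.ncard : ℝ) ≤ ({v : V | ∃ u ∈ S, E u v}.ncard : ℝ)) ∧
  (∀ S : Set V, (S.ncard : ℝ) ≤ (Fintype.card V : ℝ) / 2 →
    (1 + δ) * (S.ncard : ℝ) ≤ ({u : U | ∃ v ∈ S, E u v}.ncard : ℝ))

/-- `p(e)` for the edge `e = (u,v)`: the fraction of perfect matchings of the bipartite
graph `E` (viewed as bijections `U ≃ V` using only edges of `E`) containing `e`. -/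
noncomputable def pmProb {U V : Type*} (E : U → V → Prop) (u : U) (v : V) : ℝ :=
  ({σ : U ≃ V | (∀ x : U, E x (σ x)) ∧ σ u = v}.ncard : ℝ) /
    ({σ : U ≃ V | ∀ x : U, E x (σ x)}.ncard : ℝ)

open Classical in
/-- Bijections reachable by at most `L` rotations at `u₀`. -/
noncomputable def rotSet {U V : Type*} [Fintype U] [Fintype V] (E : U → V → Prop) (u₀ : U) :
    ℕ → (U ≃ V) → U → Finset (U ≃ V)
  | 0, ρ, _ => {ρ}
  | L + 1, ρ, l => (Finset.univ.filter (fun w => E w (ρ u₀) ∧ w ≠ l)).biUnion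
      (fun w => if w = u₀ then {ρ} else rotSet E u₀ L ((Equiv.swap u₀ w).trans ρ) w)

open Classical in
theorem rotSet_card {U V : Type*} [Fintype U] [Fintype V] (E : U → V → Prop) (u₀ : U)
    (q : ℕ) (hq : 1 ≤ q) (hdegV : ∀ v : V, ({u : U | E u v}.ncard) ≤ q + 1) (L : ℕ) :
    ∀ (ρ : U ≃ V) (l : U), (∀ y, y ≠ u₀ → E y (ρ y)) → E l (ρ u₀) →
      (rotSet E u₀ L ρ l).card ≤ q ^ L := by
  induction L with
  | zero => intro ρ l _ _; simp [rotSet]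
  | succ L ih =>
    intro ρ l h1 h2
    have hc : (Finset.univ.filter (fun w => E w (ρ u₀) ∧ w ≠ l)).card ≤ q := by
      have h3 := hdegV (ρ u₀)
      have h4 : {u : U | E u (ρ u₀)}.ncard
          = (Finset.univ.filter (fun w => E w (ρ u₀))).card := by
        rw [← Set.ncard_coe_finset]; congr 1; ext; simp
      have h5 : (Finset.univ.filter (fun w => E w (ρ u₀) ∧ w ≠ l))
          = (Finset.univ.filter (fun w => E w (ρ u₀))).erase l := by
        ext w; simp; tauto
      rw [h5, Finset.card_erase_of_mem (by simpa using h2)]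
      omega
    rw [rotSet]
    refine (Finset.card_biUnion_le_card_mul _ _ (q ^ L) ?_).trans ?_
    · intro w hw
      simp only [Finset.mem_filter, Finset.mem_univ, true_and] at hw
      split_ifs with hwu
      · simpa using Nat.one_le_pow _ _ hq
      · apply ih
        · intro y hy
          by_cases hyw : y = w
          · subst hyw; simpa using hw.1
          · simpa [Equiv.swap_apply_of_ne_of_ne hy hyw] using h1 y hy
        · simpa using h1 w hwu
    · rw [pow_succ, mul_comm]; exact Nat.mul_le_mul_left _ hc

/-- Vertices from which `u₀` is reachable in `k` steps in the digraph of `σ`. -/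
def backSet {U V : Type*} (E : U → V → Prop) (σ : U ≃ V) (u₀ : U) : ℕ → Set U
  | 0 => {u₀}
  | k + 1 => {x | ∃ y ∈ backSet E σ u₀ k, E x (σ y)}

/-- Vertices reachable from `u₀` in `k` steps in the digraph of `σ`. -/
def fwdSet {U V : Type*} (E : U → V → Prop) (σ : U ≃ V) (u₀ : U) : ℕ → Set U
  | 0 => {u₀}
  | k + 1 => {y | ∃ x ∈ fwdSet E σ u₀ k, E x (σ y)}

theorem backSet_mono {U V : Type*} (E : U → V → Prop) (σ : U ≃ V) (u₀ : U)
    (hσ : ∀ x, E x (σ x)) : Monotone (backSet E σ u₀) :=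
  monotone_nat_of_le_succ (fun _ x hx => ⟨x, hx, hσ x⟩)

theorem meet_fwd_back {U V : Type*} (E : U → V → Prop) (σ : U ≃ V) (u u₀ : U) (i : ℕ) :
    ∀ j z, z ∈ fwdSet E σ u i → z ∈ backSet E σ u₀ j → u ∈ backSet E σ u₀ (i + j) := by
  induction i with
  | zero => intro j z h1 h2; have : z = u := h1; subst this; simpa using h2
  | succ i ih =>
    rintro j z ⟨x, hx, hxz⟩ h2
    have := ih (j + 1) x hx ⟨z, h2, hxz⟩
    rwa [show i + 1 + j = i + (j + 1) by omega]

theorem exists_rot {U V : Type*} [Fintype U] [Fintype V] (E : U → V → Prop) (σ : U ≃ V)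
    (u₀ : U) (hσ : ∀ x, E x (σ x)) (k : ℕ) :
    ∀ x ∈ backSet E σ u₀ k, (∀ j < k, x ∉ backSet E σ u₀ j) →
      ∃ ρ : U ≃ V, ρ u₀ = σ x ∧ (∀ y, y ∉ backSet E σ u₀ k → ρ y = σ y) ∧
        (∀ y, y ≠ u₀ → E y (ρ y)) ∧
        ∀ l, l ≠ x → ∀ m, k ≤ m → σ ∈ rotSet E u₀ m ρ l := by
  classical
  induction k with
  | zero =>
    intro x hx _
    have : x = u₀ := hx
    subst this
    refine ⟨σ, rfl, fun _ _ => rfl, fun y _ => hσ y, ?_⟩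
    intro l hl m _
    cases m with
    | zero => simp [rotSet]
    | succ m =>
      rw [rotSet, Finset.mem_biUnion]
      exact ⟨x, by simp [hσ x, hl.symm], by simp⟩
  | succ k ih =>
    rintro x ⟨y, hy, hxy⟩ hmin
    have hxk := hmin k (by omega)
    have hu : u₀ ∈ backSet E σ u₀ k := backSet_mono E σ u₀ hσ (Nat.zero_le k) rfl
    have hxu : x ≠ u₀ := fun h => hxk (h ▸ hu)
    have hxy' : x ≠ y := fun h => hxk (h ▸ hy)
    obtain ⟨ρ, h1, h2, h3, h4⟩ := ih y hy
      (fun j hj hyj => hmin (j + 1) (by omega) ⟨y, hyj, hxy⟩)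
    refine ⟨(Equiv.swap u₀ x).trans ρ, by simp [h2 x hxk], ?_, ?_, ?_⟩
    · intro z hz
      have hzk : z ∉ backSet E σ u₀ k := fun h => hz (backSet_mono E σ u₀ hσ (Nat.le_succ k) h)
      have hzx : z ≠ x := fun h => hz (h ▸ ⟨y, hy, hxy⟩)
      have hzu : z ≠ u₀ := fun h => hzk (h ▸ hu)
      simp [Equiv.swap_apply_of_ne_of_ne hzu hzx, h2 z hzk]
    · intro z hzu
      by_cases hzx : z = x
      · subst hzx; simpa [h1] using hxy
      · simpa [Equiv.swap_apply_of_ne_of_ne hzu hzx] using h3 z hzu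
    · intro l hl m hm
      obtain ⟨m, rfl⟩ : ∃ m', m = m' + 1 := ⟨m - 1, by omega⟩
      rw [rotSet, Finset.mem_biUnion]
      refine ⟨x, by simp [h2 x hxk, hσ x, hl.symm], ?_⟩
      rw [if_neg hxu]
      have : (Equiv.swap u₀ x).trans ((Equiv.swap u₀ x).trans ρ) = ρ := by
        ext z; simp
      rw [this]
      exact h4 x hxy' m (by omega)

theorem grow_sets {U : Type*} [Finite U] (n : ℝ) (b : ℝ) (A : ℕ → Set U) (hb : 0 ≤ b)
    (h0 : (A 0).ncard = 1) (hmono : ∀ i, A i ⊆ A (i + 1))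
    (hgrow : ∀ i, ((A i).ncard : ℝ) ≤ n / 2 → b * (A i).ncard ≤ ((A (i + 1)).ncard : ℝ))
    (i : ℕ) : n / 2 < (A i).ncard ∨ b ^ i ≤ ((A i).ncard : ℝ) := by
  induction i with
  | zero => right; simp [h0]
  | succ i ih =>
    have hm : ((A i).ncard : ℝ) ≤ (A (i + 1)).ncard := by
      exact_mod_cast Set.ncard_le_ncard (hmono i)
    by_cases h : n / 2 < ((A i).ncard : ℝ)
    · left; linarith
    · right
      have h1 := hgrow i (not_lt.mp h)
      have h2 := ih.resolve_left h
      calc b ^ (i + 1) = b * b ^ i := by ring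
        _ ≤ b * (A i).ncard := by gcongr
        _ ≤ _ := h1

theorem reach {U V : Type*} [Fintype U] [Fintype V] (n : ℕ)
    (hU : Fintype.card U = n) (hV : Fintype.card V = n)
    (E : U → V → Prop) (δ : ℝ) (hδ : 0 < δ) (hexp : IsBipartiteExpander E δ)
    (σ : U ≃ V) (hσ : ∀ x, E x (σ x)) (m : ℕ) (hm : (n : ℝ) / 2 < (1 + δ) ^ m) (u u₀ : U) :
    u ∈ backSet E σ u₀ (m + m) := by
  have hA : (n : ℝ) / 2 < (fwdSet E σ u m).ncard := by
    have := grow_sets (n : ℝ) (1 + δ) (fwdSet E σ u) (by linarith) (by simp [fwdSet])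
      (fun i x hx => ⟨x, hx, hσ x⟩) (fun i hi => by
        have h := hexp.1 (fwdSet E σ u i) (by rw [hU]; exact hi)
        refine h.trans (le_of_eq ?_)
        congr 1
        rw [← Set.ncard_image_of_injective (fwdSet E σ u (i + 1)) σ.injective]
        congr 1
        ext v
        simp only [fwdSet, Set.mem_ofPred_eq, Set.mem_image]
        constructor
        · rintro ⟨x, hx, hxv⟩
          exact ⟨σ.symm v, ⟨x, hx, by simpa using hxv⟩, by simp⟩
        · rintro ⟨y, ⟨x, hx, hxy⟩, rfl⟩
          exact ⟨x, hx, hxy⟩) m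
    rcases this with h | h <;> linarith
  have hB : (n : ℝ) / 2 < (backSet E σ u₀ m).ncard := by
    have := grow_sets (n : ℝ) (1 + δ) (backSet E σ u₀) (by linarith) (by simp [backSet])
      (fun i x hx => ⟨x, hx, hσ x⟩) (fun i hi => by
        have h := hexp.2 (σ '' backSet E σ u₀ i) (by
          rw [hV, Set.ncard_image_of_injective _ σ.injective]; exact hi)
        rw [Set.ncard_image_of_injective _ σ.injective] at h
        refine h.trans (le_of_eq ?_)
        congr 2
        ext x
        constructor
        · rintro ⟨v, ⟨y, hy, rfl⟩, hxy⟩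
          exact ⟨y, hy, hxy⟩
        · rintro ⟨y, hy, hxy⟩
          exact ⟨σ y, ⟨y, hy, rfl⟩, hxy⟩) m
    rcases this with h | h <;> linarith
  have hne : (fwdSet E σ u m ∩ backSet E σ u₀ m).Nonempty := by
    by_contra hcon
    have hdisj : Disjoint (fwdSet E σ u m) (backSet E σ u₀ m) := by
      rw [Set.disjoint_iff_inter_eq_empty]; exact Set.not_nonempty_iff_eq_empty.mp hcon
    have h1 := Set.ncard_union_eq hdisj
    have h2 : (fwdSet E σ u m ∪ backSet E σ u₀ m).ncard ≤ n := by
      rw [← hU, ← Nat.card_eq_fintype_card]; exact Set.ncard_le_card _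
    have h3 : ((fwdSet E σ u m).ncard : ℝ) + (backSet E σ u₀ m).ncard ≤ n := by
      rw [h1] at h2; exact_mod_cast h2
    linarith
  obtain ⟨z, hz1, hz2⟩ := hne
  exact meet_fwd_back E σ u u₀ m m z hz1 hz2

theorem delta_le {U V : Type*} [Fintype U] [Fintype V] (n : ℕ) (hn : 2 ≤ n)
    (hU : Fintype.card U = n) (hV : Fintype.card V = n)
    (E : U → V → Prop) (δ : ℝ) (hexp : IsBipartiteExpander E δ) : 1 + δ ≤ 4 := by
  obtain ⟨S, -, hS⟩ := Finset.exists_subset_card_eq (s := (Finset.univ : Finset U)) (n := n / 2)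
    (by rw [Finset.card_univ, hU]; omega)
  have h2 : 2 * (n / 2) ≤ n := by omega
  have h2' : 2 * ((n / 2 : ℕ) : ℝ) ≤ n := by exact_mod_cast h2
  have h3 : n ≤ 4 * (n / 2) := by omega
  have h3' : (n : ℝ) ≤ 4 * ((n / 2 : ℕ) : ℝ) := by exact_mod_cast h3
  have h4 : 1 ≤ n / 2 := by omega
  have h4' : (1 : ℝ) ≤ ((n / 2 : ℕ) : ℝ) := by exact_mod_cast h4
  have h := hexp.1 (S : Set U) (by rw [Set.ncard_coe_finset, hS, hU]; linarith)
  rw [Set.ncard_coe_finset, hS] at h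
  have h5 : {v : V | ∃ u ∈ (S : Set U), E u v}.ncard ≤ n := by
    rw [← hV, ← Nat.card_eq_fintype_card]; exact Set.ncard_le_card _
  have h5' : ({v : V | ∃ u ∈ (S : Set U), E u v}.ncard : ℝ) ≤ n := by exact_mod_cast h5
  by_contra hcon
  push Not at hcon
  nlinarith

theorem numeric (n q : ℕ) (hn : 2 ≤ n) (hq : 1 ≤ q) (b : ℝ) (hb : 1 < b) (hb4 : b ≤ 4) :
    ∃ m : ℕ, (n : ℝ) / 2 < b ^ m ∧
      1 + (q : ℝ) ^ (m + m) ≤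
        ((q : ℝ) + 1) * (n : ℝ) ^ (2 * Real.log (q : ℝ) / Real.log b) := by
  have hn' : (2 : ℝ) ≤ n := by exact_mod_cast hn
  have hq' : (1 : ℝ) ≤ q := by exact_mod_cast hq
  have hlb : 0 < Real.log b := Real.log_pos hb
  have hln : 0 ≤ Real.log ((n : ℝ) / 2) := Real.log_nonneg (by linarith)
  set t := Real.log ((n : ℝ) / 2) / Real.log b with ht
  have ht0 : 0 ≤ t := by positivity
  refine ⟨⌊t⌋₊ + 1, ?_, ?_⟩
  · have h1 : t < (⌊t⌋₊ + 1 : ℕ) := by push_cast; exact Nat.lt_floor_add_one t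
    rw [ht, div_lt_iff₀ hlb, ← Real.log_pow] at h1
    exact (Real.log_lt_log_iff (by linarith) (by positivity)).mp h1
  · set M := 2 * Real.log n / Real.log b with hM
    have hM0 : 0 ≤ M := by
      have := Real.log_nonneg (show (1 : ℝ) ≤ n by linarith)
      positivity
    have hL : (((⌊t⌋₊ + 1) + (⌊t⌋₊ + 1) : ℕ) : ℝ) ≤ M + 1 := by
      have hf := Nat.floor_le ht0
      have h4 : Real.log b ≤ 2 * Real.log 2 := by
        rw [show (2 : ℝ) * Real.log 2 = Real.log 4 by
          rw [show (4 : ℝ) = 2 ^ 2 by norm_num, Real.log_pow]; norm_num]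
        exact Real.log_le_log (by linarith) hb4
      have h5 : 2 * t + 1 ≤ M := by
        have : t * Real.log b = Real.log n - Real.log 2 := by
          rw [ht, div_mul_cancel₀ _ hlb.ne', Real.log_div (by linarith) (by norm_num)]
        rw [hM, le_div_iff₀ hlb]
        nlinarith
      push_cast
      linarith
    have hpow : (n : ℝ) ^ (2 * Real.log (q : ℝ) / Real.log b) = (q : ℝ) ^ M := by
      rw [Real.rpow_def_of_pos (by linarith), Real.rpow_def_of_pos (by linarith), hM]
      congr 1; ring
    rw [hpow]
    have h1 : (q : ℝ) ^ ((⌊t⌋₊ + 1) + (⌊t⌋₊ + 1)) ≤ (q : ℝ) ^ M * q := by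
      rw [← Real.rpow_natCast, ← Real.rpow_add_one (by linarith)]
      exact Real.rpow_le_rpow_of_exponent_le hq' hL
    have h2 : (1 : ℝ) ≤ (q : ℝ) ^ M := Real.one_le_rpow hq' hM0
    nlinarith

/-- In a bipartite `δ`-expander of maximum degree `d` on `2n` vertices (`n ≥ 2`)
admitting a perfect matching, every edge `e` satisfies
`p(e) ≥ (1/d)·n^{-2·ln(d-1)/ln(1+δ)}`. -/
theorem pmProb_lower_bound_expander {U V : Type*} [Fintype U] [Fintype V]
    (n d : ℕ) (hn : 2 ≤ n) (hd : 2 ≤ d)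
    (hU : Fintype.card U = n) (hV : Fintype.card V = n)
    (E : U → V → Prop) (δ : ℝ) (hδ : 0 < δ)
    (hexp : IsBipartiteExpander E δ)
    (hdegU : ∀ u : U, ({v : V | E u v}.ncard) ≤ d)
    (hdegV : ∀ v : V, ({u : U | E u v}.ncard) ≤ d)
    (hpm : ∃ σ : U ≃ V, ∀ x : U, E x (σ x))
    (u₀ : U) (v₀ : V) (he : E u₀ v₀) :
    (1 / (d : ℝ)) * (n : ℝ) ^ (-(2 * Real.log ((d : ℝ) - 1) / Real.log (1 + δ))) ≤
      pmProb E u₀ v₀ := by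
  classical
  obtain ⟨q, rfl⟩ : ∃ q, d = q + 1 := ⟨d - 1, by omega⟩
  have hq : 1 ≤ q := by omega
  obtain ⟨m, hm, hnum⟩ := numeric n q hn hq (1 + δ) (by linarith)
    (delta_le n hn hU hV E δ hexp)
  set T : Finset (U ≃ V) := Finset.univ.filter (fun σ => (∀ x : U, E x (σ x)) ∧ σ u₀ = v₀) with hT
  set P : Finset (U ≃ V) := Finset.univ.filter (fun σ => ∀ x : U, E x (σ x)) with hP
  have hTc : {σ : U ≃ V | (∀ x : U, E x (σ x)) ∧ σ u₀ = v₀}.ncard = T.card := by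
    rw [← Set.ncard_coe_finset]; congr 1; ext; simp [hT]
  have hPc : {σ : U ≃ V | ∀ x : U, E x (σ x)}.ncard = P.card := by
    rw [← Set.ncard_coe_finset]; congr 1; ext; simp [hP]
  have hsub : P ⊆ T ∪ T.biUnion (fun τ => rotSet E u₀ (m + m) τ u₀) := by
    intro σ hσP
    have hσ : ∀ x, E x (σ x) := by simpa [hP] using hσP
    rw [Finset.mem_union]
    by_cases hσ0 : σ u₀ = v₀
    · left; simp [hT, hσ, hσ0]
    · right
      have hmem := reach n hU hV E δ hδ hexp σ hσ m hm (σ.symm v₀) u₀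
      have hex : ∃ k, σ.symm v₀ ∈ backSet E σ u₀ k := ⟨_, hmem⟩
      obtain ⟨ρ, h1, -, h3, h4⟩ := exists_rot E σ u₀ hσ (Nat.find hex) (σ.symm v₀)
        (Nat.find_spec hex) (fun j hj => Nat.find_min hex hj)
      rw [Equiv.apply_symm_apply] at h1
      rw [Finset.mem_biUnion]
      refine ⟨ρ, ?_, h4 u₀ ?_ _ (Nat.find_min' hex hmem)⟩
      · simp only [hT, Finset.mem_filter, Finset.mem_univ, true_and]
        refine ⟨fun x => ?_, h1⟩
        by_cases hx : x = u₀
        · rw [hx, h1]; exact he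
        · exact h3 x hx
      · intro h
        apply hσ0
        conv_lhs => rw [h]
        simp
  have hcard : P.card ≤ T.card * (1 + q ^ (m + m)) := by
    refine (Finset.card_le_card hsub).trans ((Finset.card_union_le _ _).trans ?_)
    rw [mul_add, mul_one]
    refine Nat.add_le_add_left (Finset.card_biUnion_le_card_mul _ _ _ ?_) _
    intro τ hτ
    simp only [hT, Finset.mem_filter, Finset.mem_univ, true_and] at hτ
    exact rotSet_card E u₀ q hq hdegV _ τ u₀ (fun y _ => hτ.1 y) (hτ.1 u₀)
  have hPpos : 0 < P.card := by
    obtain ⟨σ, hσ⟩ := hpm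
    exact Finset.card_pos.mpr ⟨σ, by simpa [hP] using hσ⟩
  unfold pmProb
  rw [hTc, hPc]
  have hcardR : (P.card : ℝ) ≤ T.card * (1 + (q : ℝ) ^ (m + m)) := by exact_mod_cast hcard
  have hPR : (0 : ℝ) < P.card := by exact_mod_cast hPpos
  have hq1 : (((q + 1 : ℕ) : ℝ) - 1) = q := by push_cast; ring
  have hn0 : (0 : ℝ) < n := by exact_mod_cast (show 0 < n by omega)
  rw [hq1, Real.rpow_neg hn0.le]
  set X := (n : ℝ) ^ (2 * Real.log (q : ℝ) / Real.log (1 + δ)) with hX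
  have hXpos : 0 < X := Real.rpow_pos_of_pos hn0 _
  have hle : (P.card : ℝ) ≤ T.card * (((q : ℝ) + 1) * X) :=
    hcardR.trans (mul_le_mul_of_nonneg_left hnum (Nat.cast_nonneg _))
  rw [one_div, ← mul_inv, le_div_iff₀ hPR, inv_mul_le_iff₀ (by positivity)]
  push_cast
  linarith
end

section
/- For every integer d ≥ 3 there exists a constant 0 < c < 1 such that for every integer n ≥ d there is a d-regular bipartite simple graph on 2n vertices with an edge e satisfying p(e) > 1 − c^n, where p(e) is the probability that a uniform random perfect matching contains e. -/
/-- The matchings of `E` (as permutations) sending `u` to `v`. -/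
def pmSet {α : Type} (E : α → α → Prop) (u v : α) : Set (Equiv.Perm α) :=
  {σ | (∀ x, E x (σ x)) ∧ σ u = v}

/-- Invariant of the inductive construction. -/
def GoodG (m C n : ℕ) (k : Fin (m+3) → ℕ) : Prop :=
  ∃ (α : Type) (_ : Fintype α) (E : α → α → Prop) (u : α) (nb : Fin (m+3) → α),
    Fintype.card α = n ∧
    (∀ x, {y | E x y}.ncard = m+3) ∧ (∀ y, {x | E x y}.ncard = m+3) ∧
    Function.Injective nb ∧ (∀ v, E u v ↔ ∃ i, nb i = v) ∧
    0 < (pmSet E u (nb 0)).ncard ∧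
    ∀ i, i ≠ 0 → (pmSet E u (nb i)).ncard * 2 ^ (k i) ≤ C * (pmSet E u (nb 0)).ncard

/-- Splicing a complete bipartite block into the edge `(u,v)`. -/
def spl {α β : Type} (E : α → α → Prop) (u v : α) (z : β) : α ⊕ β → α ⊕ β → Prop
  | .inl x, .inl y => E x y ∧ ¬ (x = u ∧ y = v)
  | .inl x, .inr b => x = u ∧ b = z
  | .inr a, .inl y => a = z ∧ y = v
  | .inr a, .inr b => ¬ (a = z ∧ b = z)

lemma ncard_sum_set {α β : Type} [Finite α] [Finite β] (S : Set (α ⊕ β)) :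
    S.ncard = {x | Sum.inl x ∈ S}.ncard + {x | Sum.inr x ∈ S}.ncard := by
  have h : S = (Set.image Sum.inl {x | Sum.inl x ∈ S}) ∪ (Set.image Sum.inr {x | Sum.inr x ∈ S}) := by
    ext x; cases x <;> simp
  conv_lhs => rw [h]
  rw [Set.ncard_union_eq, Set.ncard_image_of_injective _ Sum.inl_injective,
    Set.ncard_image_of_injective _ Sum.inr_injective]
  rw [Set.disjoint_left]; rintro _ ⟨x, _, rfl⟩ ⟨y, _, h⟩; simp at h

lemma spl_row {α β : Type} [Finite α] [Finite β] (E : α → α → Prop) (u v : α) (z : β) (d : ℕ)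
    (huv : E u v) (hd : ∀ x, {y | E x y}.ncard = d) (hb : Nat.card β = d) (x : α ⊕ β) :
    {y | spl E u v z x y}.ncard = d := by
  rw [ncard_sum_set]
  rcases x with x | a
  · by_cases hx : x = u
    · subst hx
      have h1 : {y | Sum.inl y ∈ {y | spl E x v z (Sum.inl x) y}} = {y | E x y} \ {v} := by
        ext y; simp [spl]
      have h2 : {y | Sum.inr y ∈ {y | spl E x v z (Sum.inl x) y}} = {z} := by
        ext y; simp [spl]
      rw [h1, h2, Set.ncard_singleton, Set.ncard_sdiff_singleton_add_one (by exact huv), hd]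
    · have h1 : {y | Sum.inl y ∈ {y | spl E u v z (Sum.inl x) y}} = {y | E x y} := by
        ext y; simp [spl, hx]
      have h2 : {y | Sum.inr y ∈ {y | spl E u v z (Sum.inl x) y}} = ∅ := by
        ext y; simp [spl, hx]
      rw [h1, h2, Set.ncard_empty, hd, add_zero]
  · by_cases hx : a = z
    · subst hx
      have h1 : {y | Sum.inl y ∈ {y | spl E u v a (Sum.inr a) y}} = {v} := by
        ext y; simp [spl]
      have h2 : {y | Sum.inr y ∈ {y | spl E u v a (Sum.inr a) y}} = Set.univ \ {a} := by
        ext y; simp [spl]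
      rw [h1, h2, Set.ncard_singleton, add_comm,
        Set.ncard_sdiff_singleton_add_one (Set.mem_univ _), Set.ncard_univ, hb]
    · have h1 : {y | Sum.inl y ∈ {y | spl E u v z (Sum.inr a) y}} = ∅ := by
        ext y; simp [spl, hx]
      have h2 : {y | Sum.inr y ∈ {y | spl E u v z (Sum.inr a) y}} = Set.univ := by
        ext y; simp [spl, hx]
      rw [h1, h2, Set.ncard_empty, Set.ncard_univ, hb, zero_add]

lemma spl_flip {α β : Type} (E : α → α → Prop) (u v : α) (z : β) (x y : α ⊕ β) :
    spl E u v z x y ↔ spl (fun a b => E b a) v u z y x := by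
  rcases x with x | x <;> rcases y with y | y <;> simp [spl] <;> tauto

lemma spl_col {α β : Type} [Finite α] [Finite β] (E : α → α → Prop) (u v : α) (z : β) (d : ℕ)
    (huv : E u v) (hd : ∀ y, {x | E x y}.ncard = d) (hb : Nat.card β = d) (y : α ⊕ β) :
    {x | spl E u v z x y}.ncard = d := by
  simp_rw [spl_flip E]
  exact spl_row (fun a b => E b a) v u z d huv hd hb y

lemma sumCongr_inj {α β : Type} : Function.Injective
    (fun p : Equiv.Perm α × Equiv.Perm β => Equiv.Perm.sumCongr p.1 p.2) := by
  rintro ⟨a, b⟩ ⟨c, d⟩ h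
  have h' := fun x => congrArg (fun f : Equiv.Perm (α ⊕ β) => f x) h
  simp only [Prod.mk.injEq]
  constructor
  · ext x; simpa using h' (Sum.inl x)
  · ext x; simpa using h' (Sum.inr x)

lemma exists_sumCongr {α β : Type} [Finite α] [Finite β] (σ : Equiv.Perm (α ⊕ β))
    (h : ∀ x, ∃ y, σ (Sum.inl x) = Sum.inl y) :
    ∃ p : Equiv.Perm α × Equiv.Perm β, Equiv.Perm.sumCongr p.1 p.2 = σ := by
  have := Equiv.Perm.mem_sumCongrHom_range_of_perm_mapsTo_inl (σ := σ) (by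
    rintro _ ⟨x, rfl⟩
    obtain ⟨y, hy⟩ := h x
    exact ⟨y, hy.symm⟩)
  obtain ⟨p, hp⟩ := this
  exact ⟨p, by simpa using hp⟩

lemma count_off {α β : Type} [Finite α] [Finite β] (E : α → α → Prop) (u v w : α) (z : β)
    (hwv : w ≠ v) :
    (pmSet (spl E u v z) (Sum.inl u) (Sum.inl w)).ncard =
      (pmSet E u w).ncard * {ρ : Equiv.Perm β | ρ z ≠ z}.ncard := by
  rw [← Set.ncard_prod, ← Set.ncard_image_of_injective _ sumCongr_inj]
  congr 1
  ext σ
  simp only [Set.mem_image, Set.mem_prod]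
  constructor
  · rintro ⟨h1, h2⟩
    obtain ⟨p, rfl⟩ := exists_sumCongr σ (by
      intro x
      by_cases hx : x = u
      · exact ⟨w, by rw [hx, h2]⟩
      · have := h1 (Sum.inl x)
        rcases hs : σ (Sum.inl x) with y | y
        · exact ⟨y, rfl⟩
        · rw [hs] at this; simp [spl, hx] at this)
    refine ⟨p, ⟨⟨fun x => ?_, ?_⟩, ?_⟩, rfl⟩
    · have := h1 (Sum.inl x); simp [spl] at this; exact this.1
    · simpa using h2
    · have := h1 (Sum.inr z); simpa [spl] using this
  · rintro ⟨p, ⟨⟨h1, h2⟩, h3⟩, rfl⟩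
    refine ⟨?_, by simp [h2]⟩
    rintro (x | x)
    · simp only [Equiv.Perm.sumCongr_apply, Sum.map_inl, spl]
      refine ⟨h1 x, ?_⟩
      rintro ⟨rfl, h⟩; exact hwv (h2.symm.trans h)
    · simp only [Equiv.Perm.sumCongr_apply, Sum.map_inr, spl]
      rintro ⟨rfl, h⟩; exact h3 h

lemma count_on {α β : Type} [Finite α] [Finite β] (E : α → α → Prop) (u v : α) (z : β)
    (huv : E u v) :
    (pmSet (spl E u v z) (Sum.inl u) (Sum.inr z)).ncard =
      (pmSet E u v).ncard * {ρ : Equiv.Perm β | ρ z = z}.ncard := by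
  classical
  let s : Equiv.Perm (α ⊕ β) := Equiv.swap (Sum.inl v) (Sum.inr z)
  have hss : s * s = 1 := Equiv.swap_mul_self _ _
  rw [← Set.ncard_prod, ← Set.ncard_image_of_injective _ sumCongr_inj,
    ← Set.ncard_image_of_injective _ (mul_right_injective s)]
  congr 1
  ext σ
  simp only [Set.mem_image, Set.mem_prod]
  constructor
  · rintro ⟨τ, ⟨h1, h2⟩, rfl⟩
    have hz : τ (Sum.inr z) = Sum.inl v := by
      by_contra hne
      have hm : Set.MapsTo τ (Set.range Sum.inr) (Set.range (Sum.inr : β → α ⊕ β)) := by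
        rintro _ ⟨a, rfl⟩
        have h3 := h1 (Sum.inr a)
        rcases hs : τ (Sum.inr a) with y | y
        · rw [hs] at h3
          obtain ⟨rfl, rfl⟩ := h3
          exact absurd hs hne
        · exact ⟨y, rfl⟩
      rw [← Equiv.Perm.perm_mapsTo_inl_iff_mapsTo_inr] at hm
      obtain ⟨y, hy⟩ := hm ⟨u, rfl⟩
      rw [h2] at hy
      cases hy
    obtain ⟨p, hp⟩ := exists_sumCongr (s * τ) (by
      intro x
      rw [Equiv.Perm.mul_apply]
      by_cases hx : x = u
      · exact ⟨v, by rw [hx, h2]; simp [s]⟩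
      · have h3 := h1 (Sum.inl x)
        rcases hs : τ (Sum.inl x) with y | y
        · by_cases hy : y = v
          · rw [hy, ← hz] at hs
            cases τ.injective hs
          · exact ⟨y, by simp [s, Equiv.swap_apply_def, hy]⟩
        · rw [hs] at h3; simp [spl, hx] at h3)
    have hpx : ∀ x, τ x = s (Equiv.Perm.sumCongr p.1 p.2 x) := by
      intro x
      rw [hp, ← Equiv.Perm.mul_apply, ← mul_assoc, hss, one_mul]
    have hu : p.1 u = v := by
      have := congrArg s (hpx (Sum.inl u))
      rw [h2] at this
      simpa [s, eq_comm] using this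
    have hzz : p.2 z = z := by
      have := congrArg s (hpx (Sum.inr z))
      rw [hz] at this
      simpa [s, eq_comm] using this
    refine ⟨p, ⟨⟨fun x => ?_, hu⟩, hzz⟩, hp⟩
    by_cases hx : x = u
    · rw [hx, hu]; exact huv
    · have h3 := h1 (Sum.inl x)
      have hne : p.1 x ≠ v := fun h => hx (p.1.injective (h.trans hu.symm))
      rw [hpx] at h3
      simp [s, Equiv.swap_apply_def, hne, spl] at h3
      exact h3
  · rintro ⟨p, ⟨⟨h1, h2⟩, h3⟩, rfl⟩
    have h3 : p.2 z = z := h3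
    refine ⟨s * Equiv.Perm.sumCongr p.1 p.2, ⟨?_, ?_⟩, ?_⟩
    · rintro (x | x)
      · by_cases hx : x = u
        · simp [hx, h2, s, spl]
        · have hne : p.1 x ≠ v := fun h => hx (p.1.injective (h.trans h2.symm))
          simp [s, Equiv.swap_apply_def, hne, spl, h1]
      · by_cases hx : x = z
        · simp [hx, h3, s, spl]
        · have hne : p.2 x ≠ z := fun h => hx (p.2.injective (h.trans h3.symm))
          simp [s, Equiv.swap_apply_def, hne, spl]
    · simp [h2, s]
    · simp only [← mul_assoc, hss, one_mul]

lemma perm_counts (m : ℕ) : 0 < {ρ : Equiv.Perm (Fin (m+3)) | ρ 0 = 0}.ncard ∧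
    2 * {ρ : Equiv.Perm (Fin (m+3)) | ρ 0 = 0}.ncard ≤
      {ρ : Equiv.Perm (Fin (m+3)) | ρ 0 ≠ 0}.ncard := by
  have key : ∀ i : Fin (m+3), {ρ : Equiv.Perm (Fin (m+3)) | ρ 0 = i}.ncard =
      {ρ : Equiv.Perm (Fin (m+3)) | ρ 0 = 0}.ncard := by
    intro i
    rw [← Set.ncard_image_of_injective {ρ : Equiv.Perm (Fin (m+3)) | ρ 0 = 0}
      (mul_right_injective (Equiv.swap 0 i))]
    congr 1
    ext ρ
    simp only [Set.mem_image, Set.mem_ofPred_eq]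
    constructor
    · intro h
      exact ⟨Equiv.swap 0 i * ρ, by simp [h], by simp⟩
    · rintro ⟨τ, h, rfl⟩
      simp [h]
  refine ⟨?_, ?_⟩
  · rw [Set.ncard_pos]; exact ⟨1, rfl⟩
  · have h10 : (1 : Fin (m+3)) ≠ 0 := by simp
    have h2v : 2 % (m+3) = 2 := Nat.mod_eq_of_lt (by omega)
    have h20 : (2 : Fin (m+3)) ≠ 0 := by
      intro h; have := congrArg Fin.val h; simp at this; omega
    have h12 : (1 : Fin (m+3)) ≠ 2 := by
      intro h; have := congrArg Fin.val h; simp at this; omega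
    calc _ = {ρ : Equiv.Perm (Fin (m+3)) | ρ 0 = 1}.ncard
          + {ρ : Equiv.Perm (Fin (m+3)) | ρ 0 = 2}.ncard := by rw [key 1, key 2]; ring
      _ = ({ρ : Equiv.Perm (Fin (m+3)) | ρ 0 = 1} ∪
            {ρ : Equiv.Perm (Fin (m+3)) | ρ 0 = 2}).ncard := by
          rw [Set.ncard_union_eq]
          rw [Set.disjoint_left]
          intro ρ h h'
          exact h12 (h.symm.trans h')
      _ ≤ _ := by
          refine Set.ncard_le_ncard ?_ (Set.toFinite _)
          rintro ρ (h | h)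
          · exact fun h' => h10 (h.symm.trans h')
          · exact fun h' => h20 (h.symm.trans h')

lemma good_step {m C n : ℕ} {k : Fin (m+3) → ℕ} (h : GoodG m C n k) (i : Fin (m+3)) (hi : i ≠ 0) :
    GoodG m C (n + (m+3)) (Function.update k i (k i + 1)) := by
  obtain ⟨α, _, E, u, nb, hc, hr, hl, hinj, hnb, hpos, hk⟩ := h
  obtain ⟨hA, hAB⟩ := perm_counts m
  have huv : E u (nb i) := (hnb _).2 ⟨i, rfl⟩
  have hoff : ∀ j, j ≠ i → _ := fun j hj =>
    count_off E u (nb i) (nb j) (0 : Fin (m+3)) (fun h => hj (hinj h))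
  have hon := count_on E u (nb i) (0 : Fin (m+3)) huv
  generalize {ρ : Equiv.Perm (Fin (m+3)) | ρ 0 = 0}.ncard = A at *
  generalize {ρ : Equiv.Perm (Fin (m+3)) | ρ 0 ≠ 0}.ncard = B at *
  refine ⟨α ⊕ Fin (m+3), inferInstance, spl E u (nb i) 0, Sum.inl u,
    fun j => if j = i then Sum.inr 0 else Sum.inl (nb j), by simp [hc],
    spl_row E u (nb i) 0 _ huv hr (by simp), spl_col E u (nb i) 0 _ huv hl (by simp), ?_, ?_, ?_, ?_⟩
  · intro a b hab
    dsimp only at hab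
    split_ifs at hab with h1 h2 h2
    · rw [h1, h2]
    · exact hinj (Sum.inl_injective hab)
  · rintro (v | b)
    · simp only [spl, hnb]
      constructor
      · rintro ⟨⟨j, rfl⟩, h⟩
        have hj : j ≠ i := by rintro rfl; simp at h
        exact ⟨j, by simp [hj]⟩
      · rintro ⟨j, hj⟩
        split_ifs at hj with h1
        have := Sum.inl_injective hj
        exact ⟨⟨j, this⟩, fun h => h1 (hinj (this.trans h.2))⟩
    · simp only [spl]
      constructor
      · rintro ⟨_, rfl⟩
        exact ⟨i, by simp⟩
      · rintro ⟨j, hj⟩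
        split_ifs at hj with h1
        exact ⟨trivial, (Sum.inr_injective hj).symm⟩
  · simp only [hi.symm, if_false, hoff 0 hi.symm]
    have : 0 < B := by omega
    positivity
  · intro j hj
    simp only [hi.symm, if_false, hoff 0 hi.symm]
    by_cases hji : j = i
    · subst hji
      simp only [if_true, hon, Function.update_self]
      calc _ = ((pmSet E u (nb j)).ncard * 2 ^ k j) * (2 * A) := by ring
        _ ≤ (C * (pmSet E u (nb 0)).ncard) * B := Nat.mul_le_mul (hk j hj) hAB
        _ = _ := by ring
    · simp only [hji, if_false, hoff j hji, Function.update_of_ne hji]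
      calc _ = ((pmSet E u (nb j)).ncard * 2 ^ k j) * B := by ring
        _ ≤ (C * (pmSet E u (nb 0)).ncard) * B := Nat.mul_le_mul (hk j hj) le_rfl
        _ = _ := by ring

lemma good_steps {m C n : ℕ} {k : Fin (m+3) → ℕ} (h : GoodG m C n k) (s : Finset (Fin (m+3)))
    (hs : 0 ∉ s) : GoodG m C (n + (m+3) * s.card) (fun j => if j ∈ s then k j + 1 else k j) := by
  induction s using Finset.induction_on with
  | empty => simpa using h
  | insert i s his ih =>
    simp only [Finset.mem_insert, not_or] at hs
    have := good_step (ih hs.2) i (Ne.symm hs.1)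
    rw [Finset.card_insert_of_notMem his]
    convert this using 1
    · ring
    · funext j
      by_cases hj : j = i
      · subst hj; simp [his]
      · simp [hj]

lemma good_rounds {m C n : ℕ} (h : GoodG m C n (fun _ => 0)) (r : ℕ) :
    GoodG m C (n + (m+3) * (m+2) * r) (fun j => if j = 0 then 0 else r) := by
  induction r with
  | zero => simpa using h
  | succ r ih =>
    have := good_steps ih (Finset.univ.erase 0) (by simp)
    rw [Finset.card_erase_of_mem (Finset.mem_univ _), Finset.card_univ, Fintype.card_fin] at this
    convert this using 1
    · simp; ring
    · ext j
      by_cases hj : j = 0 <;> simp [hj]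

lemma good_base (m n C : ℕ) (hn : m + 3 ≤ n) (hC : n.factorial ≤ C) :
    GoodG m C n (fun _ => 0) := by
  classical
  have : NeZero n := ⟨by omega⟩
  have hinj : Function.Injective (fun i : Fin (m+3) => ((i : ℕ) : ZMod n)) := by
    intro i j h
    have h2 := congrArg ZMod.val h
    simp only [] at h2
    rw [ZMod.val_cast_of_lt (by omega), ZMod.val_cast_of_lt (by omega)] at h2
    exact Fin.ext h2
  have hpos : 0 < (pmSet (fun x y : ZMod n => ∃ i : Fin (m+3), x + ((i : ℕ) : ZMod n) = y) 0
      (((0 : Fin (m+3)) : ℕ) : ZMod n)).ncard := by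
    rw [Set.ncard_pos]
    exact ⟨1, fun x => ⟨0, by simp⟩, by simp⟩
  refine ⟨ZMod n, inferInstance, fun x y => ∃ i : Fin (m+3), x + ((i : ℕ) : ZMod n) = y, 0,
    fun i => ((i : ℕ) : ZMod n), ZMod.card n, ?_, ?_, hinj, by simp, hpos, ?_⟩
  · intro x
    have : {y | ∃ i : Fin (m+3), x + ((i : ℕ) : ZMod n) = y}
      = Set.image (fun i : Fin (m+3) => x + ((i : ℕ) : ZMod n)) Set.univ := by ext; simp
    have hi : Function.Injective (fun i : Fin (m+3) => x + ((i : ℕ) : ZMod n)) :=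
      (add_right_injective x).comp hinj
    rw [this, Set.ncard_image_of_injective _ hi, Set.ncard_univ]
    simp
  · intro y
    have : {x | ∃ i : Fin (m+3), x + ((i : ℕ) : ZMod n) = y}
      = Set.image (fun i : Fin (m+3) => y - ((i : ℕ) : ZMod n)) Set.univ := by
        ext; simp [sub_eq_iff_eq_add, eq_comm (a := y)]
    have hi : Function.Injective (fun i : Fin (m+3) => y - ((i : ℕ) : ZMod n)) :=
      (sub_right_injective (b := y)).comp hinj
    rw [this, Set.ncard_image_of_injective _ hi, Set.ncard_univ]
    simp
  · intro i _
    rw [pow_zero, mul_one]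
    refine le_trans (b := n.factorial) ?_ (hC.trans (Nat.le_mul_of_pos_right _ hpos))
    refine (Set.ncard_le_card _).trans ?_
    rw [Nat.card_eq_fintype_card, Fintype.card_perm, ZMod.card]

/-- Transfer to `Fin n`, with totals. -/
lemma good_final {m C n r : ℕ} (h : GoodG m C n (fun j => if j = 0 then 0 else r)) :
    ∃ E : Fin n → Fin n → Prop,
      (∀ u : Fin n, ({v : Fin n | E u v}.ncard) = m+3) ∧
      (∀ v : Fin n, ({u : Fin n | E u v}.ncard) = m+3) ∧
      (∃ σ : Fin n ≃ Fin n, ∀ u : Fin n, E u (σ u)) ∧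
      ∃ u₀ v₀ : Fin n, E u₀ v₀ ∧ ∃ a b : ℕ, 0 < a ∧ b * 2 ^ r ≤ ((m+3) * C) * a ∧
        pmProb E u₀ v₀ = (a : ℝ) / ((a : ℝ) + b) := by
  classical
  obtain ⟨α, _, E, u, nb, hc, hr, hl, hinj, hnb, hpos, hk⟩ := h
  let e : α ≃ Fin n := Fintype.equivFinOfCardEq hc
  have htr : ∀ P : Equiv.Perm α → Prop,
      {σ : Equiv.Perm (Fin n) | P (e.symm.permCongr σ)}.ncard = {σ | P σ}.ncard := by
    intro P
    rw [← Set.ncard_image_of_injective _ (e.symm.permCongr).injective]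
    congr 1
    ext σ
    simp only [Set.mem_image, Set.mem_ofPred_eq]
    constructor
    · rintro ⟨τ, h, rfl⟩; exact h
    · intro h
      have h' := e.symm.permCongr.apply_symm_apply σ
      exact ⟨e.symm.permCongr.symm σ, h'.symm ▸ h, h'⟩
  have htr1 : ∀ P : α → Prop, {x : Fin n | P (e.symm x)}.ncard = {x | P x}.ncard := by
    intro P
    rw [← Set.ncard_image_of_injective _ e.symm.injective]
    congr 1
    ext x
    simp only [Set.mem_image, Set.mem_ofPred_eq]
    constructor
    · rintro ⟨τ, h, rfl⟩; exact h
    · intro h; exact ⟨e x, by simpa using h, by simp⟩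
  have hall : ∀ σ : Equiv.Perm (Fin n), (∀ x, E (e.symm x) (e.symm (σ x))) ↔
      ∀ x, E x (e.symm.permCongr σ x) := by
    intro σ
    simp only [Equiv.permCongr_apply, Equiv.symm_symm]
    constructor
    · intro h x; simpa using h (e x)
    · intro h x; simpa using h (e.symm x)
  refine ⟨fun x y => E (e.symm x) (e.symm y), fun x => ?_, fun y => ?_, ?_, e u, e (nb 0), ?_,
    (pmSet E u (nb 0)).ncard, {σ : Equiv.Perm α | (∀ x, E x (σ x)) ∧ σ u ≠ nb 0}.ncard, hpos, ?_, ?_⟩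
  · rw [htr1 (fun y => E (e.symm x) y), hr]
  · rw [htr1 (fun x => E x (e.symm y)), hl]
  · rw [Set.ncard_pos] at hpos
    obtain ⟨σ, h1, _⟩ := hpos
    exact ⟨e.permCongr σ, fun x => by simpa using h1 (e.symm x)⟩
  · simpa using (hnb _).2 ⟨0, rfl⟩
  · have hsub : {σ : Equiv.Perm α | (∀ x, E x (σ x)) ∧ σ u ≠ nb 0} ⊆
        ⋃ i ∈ (Finset.univ.erase (0 : Fin (m+3))), pmSet E u (nb i) := by
      rintro σ ⟨h1, h2⟩
      obtain ⟨i, hi⟩ := (hnb _).1 (h1 u)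
      simp only [Set.mem_iUnion]
      refine ⟨i, ?_, h1, hi.symm⟩
      simp only [Finset.mem_erase, Finset.mem_univ, and_true]
      rintro rfl; exact h2 hi.symm
    have h1 := (Set.ncard_le_ncard hsub).trans (Finset.set_ncard_biUnion_le _ _)
    calc _ ≤ (∑ i ∈ (Finset.univ.erase (0 : Fin (m+3))), (pmSet E u (nb i)).ncard) * 2 ^ r := 
          Nat.mul_le_mul h1 le_rfl
      _ = ∑ i ∈ (Finset.univ.erase (0 : Fin (m+3))), (pmSet E u (nb i)).ncard * 2 ^ r := by
          rw [Finset.sum_mul]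
      _ ≤ ∑ i ∈ (Finset.univ.erase (0 : Fin (m+3))), C * (pmSet E u (nb 0)).ncard := by
          apply Finset.sum_le_sum
          intro i hi
          have hi := Finset.ne_of_mem_erase hi
          simpa [hi] using hk i hi
      _ ≤ _ := by
          rw [Finset.sum_const, smul_eq_mul, mul_assoc]
          apply Nat.mul_le_mul _ le_rfl
          exact (Finset.card_le_univ _).trans (by simp)
  · unfold pmProb
    have hA : {σ : Fin n ≃ Fin n | (∀ x, E (e.symm x) (e.symm (σ x))) ∧ σ (e u) = e (nb 0)}.ncard
        = (pmSet E u (nb 0)).ncard := by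
      rw [pmSet, ← htr]
      congr 1
      ext σ
      simp only [Set.mem_ofPred_eq, hall]
      simp [Equiv.symm_apply_eq]
    have hT : {σ : Fin n ≃ Fin n | ∀ x, E (e.symm x) (e.symm (σ x))}.ncard
        = (pmSet E u (nb 0)).ncard +
          {σ : Equiv.Perm α | (∀ x, E x (σ x)) ∧ σ u ≠ nb 0}.ncard := by
      have : {σ : Fin n ≃ Fin n | ∀ x, E (e.symm x) (e.symm (σ x))}
        = {σ : Fin n ≃ Fin n | ∀ x, E x (e.symm.permCongr σ x)} := by
        ext σ; exact hall σ
      rw [this, htr (fun σ => ∀ x, E x (σ x)), ← Set.ncard_union_eq]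
      · congr 1
        ext σ
        simp only [pmSet, Set.mem_union, Set.mem_ofPred_eq]
        tauto
      · rw [Set.disjoint_left]
        rintro σ ⟨_, h⟩ ⟨_, h'⟩
        exact h' h
    rw [hA, hT]
    push_cast
    rfl

lemma pow_bound (C : ℝ) (hC : 1 ≤ C) (r : ℕ) :
    C * (1 + 1 / (4 * (1 + C))) ^ (r + 2) < 2 ^ r + C := by
  have hd0 : 0 < 1 / (4 * (1 + C)) := by positivity
  have hd1 : 1 / (4 * (1 + C)) * (1 + C) = 1 / 4 := by field_simp
  generalize 1 / (4 * (1 + C)) = δ at *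
  induction r with
  | zero =>
    have h3 : δ * C ≤ 1 / 4 := by linarith
    have h4 : δ ≤ 1 / 4 := by nlinarith
    have h5 : δ * (δ * C) ≤ 1 / 4 * (1 / 4) := mul_le_mul h4 h3 (by positivity) (by norm_num)
    norm_num
    nlinarith
  | succ r ih =>
    have h2 : (1 : ℝ) ≤ 2 ^ r := one_le_pow₀ (by norm_num)
    calc C * (1 + δ) ^ (r + 1 + 2) = (C * (1 + δ) ^ (r + 2)) * (1 + δ) := by ring
      _ < (2 ^ r + C) * (1 + δ) := by gcongr
      _ ≤ 2 ^ (r + 1) + C := by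
        rw [pow_succ]
        nlinarith [mul_nonneg (sub_nonneg.2 h2) hd0.le, mul_nonneg (sub_nonneg.2 h2) (sub_nonneg.2 hC)]

theorem exists_regular_bipartite_graph_probable_edge (d : ℕ) (hd : 3 ≤ d) :
    ∃ c : ℝ, 0 < c ∧ c < 1 ∧
      ∀ n : ℕ, d ≤ n →
        ∃ E : Fin n → Fin n → Prop,
          (∀ u : Fin n, ({v : Fin n | E u v}.ncard) = d) ∧
          (∀ v : Fin n, ({u : Fin n | E u v}.ncard) = d) ∧
          (∃ σ : Fin n ≃ Fin n, ∀ u : Fin n, E u (σ u)) ∧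
          ∃ u₀ v₀ : Fin n, E u₀ v₀ ∧ 1 - c ^ n < pmProb E u₀ v₀ := by
  obtain ⟨m, rfl⟩ := Nat.exists_eq_add_of_le' hd
  set D := (m+3) * (m+3) with hD
  set K : ℕ := (m+3) * D.factorial with hK
  have hK1 : 1 ≤ K := Nat.mul_pos (by omega) (Nat.factorial_pos _)
  have hKR : (1 : ℝ) ≤ K := by exact_mod_cast hK1
  set t : ℝ := 1 + 1 / (4 * (1 + (K : ℝ))) with ht
  have ht1 : 1 < t := by rw [ht]; linarith [show 0 < 1 / (4 * (1 + (K : ℝ))) by positivity]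
  have ht0 : 0 < t := by linarith
  have hDpos : D ≠ 0 := by positivity
  have hcD : (t⁻¹ ^ ((D : ℝ)⁻¹)) ^ D = t⁻¹ := Real.rpow_inv_natCast_pow (by positivity) hDpos
  have hc0 : 0 < t⁻¹ ^ ((D : ℝ)⁻¹) := by positivity
  have hc1 : t⁻¹ ^ ((D : ℝ)⁻¹) < 1 :=
    Real.rpow_lt_one (by positivity) (inv_lt_one_of_one_lt₀ ht1) (by positivity)
  generalize t⁻¹ ^ ((D : ℝ)⁻¹) = c at *
  refine ⟨c, hc0, hc1, fun n hn => ?_⟩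
  obtain ⟨n0, r, hn0, hn0D, hnr⟩ : ∃ n0 r, m + 3 ≤ n0 ∧ n0 ≤ D ∧ n = n0 + (m+3) * (m+2) * r := by
    refine ⟨m + 3 + (n - (m+3)) % ((m+3)*(m+2)), (n - (m+3)) / ((m+3)*(m+2)), by omega, ?_, ?_⟩
    · have := Nat.mod_lt (n - (m+3)) (show (m+3)*(m+2) > 0 by positivity)
      have h2 : D = (m+3) + (m+3)*(m+2) := by rw [hD]; ring
      omega
    · have := Nat.mod_add_div (n - (m+3)) ((m+3)*(m+2))
      omega
  have hg := good_rounds (good_base m n0 D.factorial hn0 (Nat.factorial_le hn0D)) r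
  rw [← hnr] at hg
  obtain ⟨E, h1, h2, h3, u, v, huv, a, b, ha, hb, hp⟩ := good_final hg
  refine ⟨E, h1, h2, h3, u, v, huv, ?_⟩
  rw [hp]
  have hnD : n ≤ D * (r + 2) := by
    have h2 : D = (m+3) + (m+3)*(m+2) := by rw [hD]; ring
    rw [hnr]; nlinarith
  have hcn : (t ^ (r+2))⁻¹ ≤ c ^ n := by
    rw [← inv_pow, ← hcD, ← pow_mul]
    exact pow_le_pow_of_le_one hc0.le hc1.le hnD
  have haR : (0 : ℝ) < a := by exact_mod_cast ha
  have hb0 : (0 : ℝ) ≤ b := by positivity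
  have hbR : (b : ℝ) * 2 ^ r ≤ K * a := by exact_mod_cast hb
  have hpb : K * t ^ (r + 2) < 2 ^ r + K := pow_bound K hKR r
  have hT : 0 < t ^ (r+2) := by positivity
  generalize t ^ (r+2) = T at *
  have hlt : (b : ℝ) < T⁻¹ * (a + b) := by
    rw [inv_mul_eq_div, lt_div_iff₀ hT]
    have h4 : (b : ℝ) * (2 ^ r + K) ≤ K * (a + b) := by linarith
    rcases hb0.eq_or_lt with h | h
    · rw [← h]; simpa using haR
    · have h5 : K * (b * T) < K * ((a : ℝ) + b) := by
        calc K * (b * T) = b * (K * T) := by ring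
          _ < b * (2 ^ r + K) := by gcongr
          _ ≤ _ := h4
      exact lt_of_mul_lt_mul_left h5 (by positivity)
  have : (b : ℝ) < c ^ n * (a + b) := hlt.trans_le (by gcongr)
  rw [lt_div_iff₀ (by positivity)]
  linarith
end

section
/- Schrijver's theorem: every d-regular bipartite graph G on 2n vertices has at least ((d−1)^{d−1}/d^{d−2})^n perfect matchings. -/
open Finset

/-- Factorization of a complex polynomial with nonzero constant term. -/
lemma sch_factor (P : Polynomial ℂ) (h0 : P.coeff 0 ≠ 0) :
    ∃ S : Multiset ℂ, Multiset.card S ≤ P.natDegree ∧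
      (∀ t : ℂ, P.eval t = P.coeff 0 * (S.map (fun s => 1 + t * s)).prod) ∧
      P.coeff 1 = P.coeff 0 * S.sum ∧ ∀ s ∈ S, s ≠ 0 ∧ P.eval (-s⁻¹) = 0 := by
  have hP : P ≠ 0 := by rintro rfl; simp at h0
  have hspl := (IsAlgClosed.splits P).eq_prod_roots
  have hr : ∀ r ∈ P.roots, r ≠ 0 := by
    rintro r hr rfl
    rw [Polynomial.mem_roots hP, Polynomial.IsRoot, ← Polynomial.coeff_zero_eq_eval_zero] at hr
    exact h0 hr
  have key : ∀ M : Multiset ℂ, (∀ r ∈ M, r ≠ 0) →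
      (M.map (fun a => Polynomial.X - Polynomial.C a)).prod =
        Polynomial.C ((M.map (fun a => -a)).prod) *
          ((M.map (fun a => -a⁻¹)).map (fun s => 1 + Polynomial.X * Polynomial.C s)).prod := by
    intro M
    induction M using Multiset.induction with
    | empty => simp
    | cons a M ih =>
      intro hM
      have ha : a ≠ 0 := hM a (by simp)
      have := ih (fun r hr => hM r (by simp [hr]))
      simp only [Multiset.map_cons, Multiset.prod_cons, this, Polynomial.C_mul]
      have h2 : (Polynomial.X - Polynomial.C a : Polynomial ℂ) =
          Polynomial.C (-a) * (1 + Polynomial.X * Polynomial.C (-a⁻¹)) := by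
        rw [mul_add, mul_left_comm, ← Polynomial.C_mul]
        simp [ha]
        ring
      rw [h2]; ring
  have key1 : ∀ M : Multiset ℂ,
      ((M.map (fun s => 1 + Polynomial.X * Polynomial.C s)).prod).coeff 0 = 1 ∧
      ((M.map (fun s => 1 + Polynomial.X * Polynomial.C s)).prod).coeff 1 = M.sum := by
    intro M
    induction M using Multiset.induction with
    | empty => simp [Polynomial.coeff_one]
    | cons a M ih =>
      simp only [Multiset.map_cons, Multiset.prod_cons, Multiset.sum_cons, add_mul, one_mul,
        mul_assoc, Polynomial.coeff_add, Polynomial.coeff_X_mul, Polynomial.coeff_C_mul,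
        Polynomial.coeff_X_mul_zero, ih]
      simp [add_comm]
  set S := P.roots.map (fun a => -a⁻¹) with hS
  have hQ : P = Polynomial.C (P.coeff 0) *
      (S.map (fun s => 1 + Polynomial.X * Polynomial.C s)).prod := by
    have h1 := hspl
    rw [key _ hr, ← mul_assoc, ← Polynomial.C_mul] at h1
    have h2 : P.coeff 0 = P.leadingCoeff * (P.roots.map (fun a => -a)).prod := by
      conv_lhs => rw [h1]
      rw [Polynomial.coeff_C_mul, (key1 _).1, mul_one]
    rw [h2]; exact h1
  refine ⟨S, ?_, ?_, ?_, ?_⟩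
  · rw [hS, Multiset.card_map]; exact P.card_roots'
  · intro t
    conv_lhs => rw [hQ]
    rw [Polynomial.eval_mul, Polynomial.eval_C, Polynomial.eval_multiset_prod, Multiset.map_map]
    congr 2
    refine Multiset.map_congr rfl fun s _ => ?_
    simp [Polynomial.eval_mul]
    exact mul_comm _ _
  · conv_lhs => rw [hQ]
    rw [Polynomial.coeff_C_mul, (key1 _).2]
  · intro s hs
    obtain ⟨a, ha, rfl⟩ := Multiset.mem_map.1 hs
    refine ⟨by simpa using hr a ha, ?_⟩
    have := (Polynomial.mem_roots hP).1 ha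
    simpa [inv_neg] using this

lemma sch_amgm (M : Multiset ℝ) (m t : ℝ) (hm : 0 ≤ m) (ht : 0 ≤ t) (hM : ∀ s ∈ M, 0 ≤ s) :
    (M.map (fun s => 1 + t * s)).prod ≤
      (1 + m) ^ Multiset.card M * Real.exp ((t * M.sum - Multiset.card M * m) / (1 + m)) := by
  induction M using Multiset.induction with
  | empty => simp
  | cons a M ih =>
    have ha : 0 ≤ a := hM a (by simp)
    have ih := ih (fun r hr => hM r (by simp [hr]))
    simp only [Multiset.map_cons, Multiset.prod_cons, Multiset.sum_cons, Multiset.card_cons]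
    have h1 : 1 + t * a ≤ (1 + m) * Real.exp ((t * a - m) / (1 + m)) := by
      have := Real.add_one_le_exp ((t * a - m) / (1 + m))
      calc 1 + t * a = (1 + m) * ((t * a - m) / (1 + m) + 1) := by field_simp; ring
        _ ≤ _ := by gcongr
    calc _ ≤ ((1 + m) * Real.exp ((t * a - m) / (1 + m))) * _ := by
          apply mul_le_mul h1 ih _ (by positivity)
          apply Multiset.prod_nonneg
          intro x hx
          obtain ⟨b, hb, rfl⟩ := Multiset.mem_map.1 hx
          have := hM b (by simp [hb])
          positivity
      _ = _ := by
          rw [mul_mul_mul_comm, ← Real.exp_add, ← add_div, pow_succ']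
          congr 3
          push_cast; ring

lemma sch_amgm' (M : Multiset ℝ) (d : ℕ) (hd : 1 ≤ d) (hc : Multiset.card M ≤ d) (t : ℝ)
    (ht : 0 ≤ t) (hM : ∀ s ∈ M, 0 ≤ s) :
    (M.map (fun s => 1 + t * s)).prod ≤ (1 + t * M.sum / d) ^ d := by
  have hs : 0 ≤ M.sum := Multiset.sum_nonneg hM
  have hd' : (0 : ℝ) < d := by exact_mod_cast hd
  have := sch_amgm (M + Multiset.replicate (d - Multiset.card M) 0) (t * M.sum / d) t
    (by positivity) ht (by
      intro s hs
      rcases Multiset.mem_add.1 hs with h | h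
      · exact hM s h
      · exact (Multiset.eq_of_mem_replicate h).ge)
  have hc2 : Multiset.card M + (d - Multiset.card M) = d := by omega
  simp only [Multiset.map_add, Multiset.prod_add, Multiset.map_replicate, mul_zero, add_zero,
    Multiset.prod_replicate, one_pow, mul_one, Multiset.card_add, Multiset.card_replicate, hc2,
    Multiset.sum_add, Multiset.sum_replicate, smul_zero] at this
  rw [mul_div_cancel₀ _ hd'.ne'] at this
  simpa using this

/-- The univariate capacity inequality, numerical part. -/
lemma sch_num (d : ℕ) (hd : 1 ≤ d) (r a C : ℝ) (hr : 0 ≤ r) (ha : 0 ≤ a) (hC : 0 < C)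
    (h : ∀ t : ℝ, 0 < t → C * t ≤ r * (1 + t * a / d) ^ d) :
    (((d : ℝ) - 1) / d) ^ (d - 1) * C ≤ r * a := by
  rcases ha.eq_or_lt with rfl | ha
  · exfalso
    have := h ((r + 1) / C) (by positivity)
    rw [mul_div_cancel₀ _ hC.ne'] at this
    simp at this
    linarith
  obtain ⟨e, rfl⟩ : ∃ e, d = e + 1 := ⟨d - 1, by omega⟩
  rcases Nat.eq_zero_or_pos e with rfl | he
  · simp at h ⊢
    by_contra! hlt
    have := h ((r + 1) / (C - r * a)) (div_pos (by linarith) (by linarith))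
    have h2 : (C - r * a) * ((r + 1) / (C - r * a)) = r + 1 := by
      rw [mul_div_cancel₀]; linarith
    nlinarith
  · have he' : (0 : ℝ) < e := by exact_mod_cast he
    have := h ((e + 1) / (a * e)) (by positivity)
    push_cast at this ⊢
    have e1 : (1 + ((e : ℝ) + 1) / (a * e) * a / (e + 1)) = (e + 1) / e := by field_simp
    rw [e1, pow_succ, div_pow] at this
    simp only [add_sub_cancel_right, div_pow]
    rw [div_mul_eq_mul_div, div_le_iff₀ (by positivity)]
    have h3 : C * (((e : ℝ) + 1) / (a * e)) = (C / a) * ((e + 1) / e) := by field_simp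
    rw [h3, ← mul_assoc] at this
    have h4 := le_of_mul_le_mul_right this (by positivity)
    rw [div_le_iff₀ ha, mul_div_assoc', div_mul_eq_mul_div, le_div_iff₀ (by positivity)] at h4
    nlinarith

/-- If `C t ≤ ‖P t‖` for all `t > 0` and `P 0 = 0` then the linear coefficient is at least C. -/
lemma sch_zero (P : Polynomial ℂ) (C : ℝ) (h0 : P.coeff 0 = 0)
    (h : ∀ t : ℝ, 0 < t → C * t ≤ ‖P.eval (t : ℂ)‖) : C ≤ ‖P.coeff 1‖ := by
  obtain ⟨Q, rfl⟩ := Polynomial.X_dvd_iff.2 h0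
  rw [Polynomial.coeff_X_mul, Polynomial.coeff_zero_eq_eval_zero]
  have hcont : Continuous fun t : ℝ => ‖Q.eval (t : ℂ)‖ := by fun_prop
  have ht := (hcont.tendsto 0).mono_left (nhdsWithin_le_nhds (s := Set.Ioi 0))
  simp only [Complex.ofReal_zero] at ht
  refine ge_of_tendsto ht ?_
  filter_upwards [self_mem_nhdsWithin] with t ht
  have ht : 0 < t := ht
  have := h t ht
  simp only [Polynomial.eval_mul, Polynomial.eval_X, norm_mul, Complex.norm_real,
    Real.norm_eq_abs, abs_of_pos ht] at this
  rw [mul_comm] at this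
  exact le_of_mul_le_mul_left this ht

lemma sch_norm_prod (S : Multiset ℂ) (t : ℝ) (ht : 0 ≤ t) :
    ‖(S.map (fun s => 1 + (t : ℂ) * s)).prod‖ ≤ ((S.map norm).map (fun s => 1 + t * s)).prod := by
  induction S using Multiset.induction with
  | empty => simp
  | cons a M ih =>
    simp only [Multiset.map_cons, Multiset.prod_cons, norm_mul]
    apply mul_le_mul _ ih (norm_nonneg _) (by positivity)
    refine (norm_add_le _ _).trans ?_
    simp [abs_of_nonneg ht]

lemma sch_re_sum (S : Multiset ℂ) (h : ∀ s ∈ S, s.re = ‖s‖) : S.sum.re = (S.map norm).sum := by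
  induction S using Multiset.induction with
  | empty => simp
  | cons a M ih =>
    simp only [Multiset.map_cons, Multiset.sum_cons, Complex.add_re]
    rw [ih (fun s hs => h s (by simp [hs])), h a (by simp)]

/-- The univariate capacity inequality. -/
lemma sch_univ (P : Polynomial ℂ) (d : ℕ) (hd : 1 ≤ d) (hdeg : P.natDegree ≤ d) (C : ℝ)
    (hC : 0 < C) (hroot : ∀ t : ℂ, P.eval t = 0 → t.re = -‖t‖)
    (h : ∀ t : ℝ, 0 < t → C * t ≤ ‖P.eval (t : ℂ)‖) :
    (((d : ℝ) - 1) / d) ^ (d - 1) * C ≤ ‖P.coeff 1‖ := by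
  have hd' : (1 : ℝ) ≤ d := by exact_mod_cast hd
  by_cases h0 : P.coeff 0 = 0
  · refine le_trans ?_ (sch_zero P C h0 h)
    have : (((d : ℝ) - 1) / d) ^ (d - 1) ≤ 1 := by
      apply pow_le_one₀
      · apply div_nonneg <;> linarith
      · rw [div_le_one] <;> linarith
    nlinarith
  obtain ⟨S, hc, he, h1, hs⟩ := sch_factor P h0
  have hre : ∀ s ∈ S, s.re = ‖s‖ := by
    intro s hs'
    obtain ⟨hne, hz⟩ := hs s hs'
    have := hroot _ hz
    have hn : 0 < Complex.normSq s := Complex.normSq_pos.2 hne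
    rw [Complex.neg_re, Complex.inv_re, norm_neg, norm_inv, neg_inj,
      Complex.normSq_eq_norm_sq] at this
    have hn : 0 < ‖s‖ := norm_pos_iff.2 hne
    field_simp at this
    exact this
  have hpos : ∀ s ∈ S.map norm, 0 ≤ s := by
    intro s hs
    obtain ⟨b, hb, rfl⟩ := Multiset.mem_map.1 hs
    exact norm_nonneg b
  have ha : (S.map norm).sum ≤ ‖S.sum‖ := by
    rw [← sch_re_sum S hre]; exact Complex.re_le_norm _
  rw [h1, norm_mul]
  refine le_trans ?_ (mul_le_mul_of_nonneg_left ha (norm_nonneg _))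
  apply sch_num d hd _ _ C (norm_nonneg _) (Multiset.sum_nonneg hpos) hC
  intro t ht
  refine (h t ht).trans ?_
  rw [he, norm_mul]
  apply mul_le_mul_of_nonneg_left _ (norm_nonneg _)
  refine (sch_norm_prod S t ht.le).trans ?_
  exact sch_amgm' _ d hd (by simpa using hc.trans hdeg) t ht.le hpos

/-- Nonvanishing of the linear coefficient. -/
lemma sch_ne (P : Polynomial ℂ) (C : ℝ) (hC : 0 < C)
    (hroot : ∀ t : ℂ, P.eval t = 0 → t = 0 ∨ t.re < 0)
    (h : ∀ t : ℝ, 0 < t → C * t ≤ ‖P.eval (t : ℂ)‖) : P.coeff 1 ≠ 0 := by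
  by_cases h0 : P.coeff 0 = 0
  · have := sch_zero P C h0 h
    exact norm_pos_iff.1 (hC.trans_le this)
  obtain ⟨S, hc, he, h1, hs⟩ := sch_factor P h0
  have hre : ∀ s ∈ S, 0 < s.re := by
    intro s hs'
    obtain ⟨hne, hz⟩ := hs s hs'
    rcases hroot _ hz with h | h
    · simp [hne] at h
    · have hn : 0 < Complex.normSq s := Complex.normSq_pos.2 hne
      rw [Complex.neg_re, Complex.inv_re, neg_lt_zero] at h
      exact (div_pos_iff_of_pos_right hn).1 h
  have hS : S ≠ 0 := by
    rintro rfl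
    have := h ((‖P.coeff 0‖ + 1) / C) (by positivity)
    rw [he, mul_div_cancel₀ _ hC.ne'] at this
    simp at this
    linarith
  rw [h1]
  refine mul_ne_zero h0 ?_
  have : ∀ M : Multiset ℂ, (∀ s ∈ M, 0 < s.re) → 0 ≤ M.sum.re ∧ (M ≠ 0 → 0 < M.sum.re) := by
    intro M
    induction M using Multiset.induction with
    | empty => simp
    | cons a M ih =>
      intro hM
      have h1 := (ih (fun s hs => hM s (by simp [hs]))).1
      have h2 := hM a (by simp)
      simp only [Multiset.sum_cons, Complex.add_re]
      exact ⟨by linarith, fun _ => by linarith⟩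
  intro hz
  have := (this S hre).2 hS
  rw [hz] at this
  simp at this

lemma sch_im (P : Polynomial ℂ) (h0 : P.coeff 0 ≠ 0)
    (hroot : ∀ t : ℂ, P.eval t = 0 → (t⁻¹).re = 0) : ‖P.eval 0‖ ≤ ‖P.eval 1‖ := by
  obtain ⟨S, hc, he, h1, hs⟩ := sch_factor P h0
  have hre : ∀ s ∈ S, s.re = 0 := by
    intro s hs'
    obtain ⟨hne, hz⟩ := hs s hs'
    have := hroot _ hz
    simpa [inv_neg] using this
  rw [← Polynomial.coeff_zero_eq_eval_zero, he, norm_mul]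
  refine le_mul_of_one_le_right (norm_nonneg _) ?_
  clear he hc h1 hs
  induction S using Multiset.induction with
  | empty => simp
  | cons a M ih =>
    simp only [Multiset.map_cons, Multiset.prod_cons, norm_mul]
    have h1 := ih (fun s hs => hre s (by simp [hs]))
    have h2 : 1 ≤ ‖1 + 1 * a‖ := by
      refine le_trans ?_ (Complex.re_le_norm _)
      simp [hre a (by simp)]
    exact one_le_mul_of_one_le_of_one_le h2 h1

open MvPolynomial in
lemma sch_hom {k m : ℕ} (p : MvPolynomial (Fin k) ℂ) (hp : p.IsHomogeneous m) (c : ℂ)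
    (z : Fin k → ℂ) : eval (fun i => c * z i) p = c ^ m * eval z p := by
  rw [eval_eq', eval_eq', Finset.mul_sum]
  refine Finset.sum_congr rfl fun d hd => ?_
  have hdeg := hp.degree_eq_sum_deg_support hd
  simp only [mul_pow, Finset.prod_mul_distrib]
  rw [Finset.prod_pow_eq_pow_sum]
  have : ∑ i, d i = m := by
    rw [hdeg]
    refine (Finset.sum_subset (Finset.subset_univ _) ?_).symm
    intro i _ hi
    simpa using hi
  rw [this]; ring

open MvPolynomial in
lemma sch_lower {k m : ℕ} (p : MvPolynomial (Fin k) ℂ) (hp : p.IsHomogeneous m)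
    (hst : ∀ z : Fin k → ℂ, (∀ i, 0 < (z i).re) → eval z p ≠ 0)
    (z : Fin k → ℂ) (hz : ∀ i, 0 < (z i).re) :
    ‖eval (fun i => ((z i).re : ℂ)) p‖ ≤ ‖eval z p‖ := by
  set P : Polynomial ℂ := aeval (fun i => Polynomial.C ((z i).re : ℂ) +
    Polynomial.C (Complex.I * (z i).im) * Polynomial.X) p with hP
  have hev : ∀ w : ℂ, P.eval w = eval (fun i => (z i).re + Complex.I * (z i).im * w) p := by
    intro w
    rw [hP, ← Polynomial.coe_evalRingHom, MvPolynomial.aeval_def, ← MvPolynomial.coe_eval₂Hom,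
      MvPolynomial.map_eval₂Hom, MvPolynomial.eval, MvPolynomial.coe_eval₂Hom,
      MvPolynomial.coe_eval₂Hom]
    congr 1
    · ext x; simp
    · ext i; simp
  have h0 : P.eval 0 = eval (fun i => ((z i).re : ℂ)) p := by
    rw [hev]; simp
  have h1 : P.eval 1 = eval z p := by
    rw [hev]; congr 2; ext i
    rw [mul_one, mul_comm]; exact Complex.re_add_im _
  rw [← h0, ← h1]
  apply sch_im
  · rw [Polynomial.coeff_zero_eq_eval_zero, h0]
    exact hst _ (by simpa using hz)
  · intro w hw
    by_contra hne
    have hw0 : w ≠ 0 := by rintro rfl; simp at hne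
    rw [hev] at hw
    rcases lt_or_gt_of_ne hne with hneg | hpos
    · have := sch_hom p hp (-w) (fun i => -(w⁻¹ * (z i).re + Complex.I * (z i).im))
      have e : (fun i => -w * -(w⁻¹ * (z i).re + Complex.I * (z i).im)) =
          (fun i => ((z i).re : ℂ) + Complex.I * (z i).im * w) := by
        ext i; field_simp
      rw [e, hw] at this
      have h3 := hst (fun i => -(w⁻¹ * (z i).re + Complex.I * (z i).im)) (by
        intro i
        have := mul_neg_of_neg_of_pos hneg (hz i)
        simp only [Complex.neg_re, Complex.add_re, Complex.re_mul_ofReal, Complex.I_re]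
        linarith)
      rcases mul_eq_zero.1 this.symm with h | h
      · exact hw0 (by simpa using eq_zero_of_pow_eq_zero h)
      · exact h3 h
    · have := sch_hom p hp w (fun i => (w⁻¹ * (z i).re + Complex.I * (z i).im))
      have e : (fun i => w * (w⁻¹ * (z i).re + Complex.I * (z i).im)) =
          (fun i => ((z i).re : ℂ) + Complex.I * (z i).im * w) := by
        ext i; field_simp
      rw [e, hw] at this
      have h3 := hst (fun i => (w⁻¹ * (z i).re + Complex.I * (z i).im)) (by
        intro i
        have := mul_pos hpos (hz i)
        simp only [Complex.add_re, Complex.re_mul_ofReal, Complex.I_re]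
        linarith)
      rcases mul_eq_zero.1 this.symm with h | h
      · exact hw0 (by simpa using eq_zero_of_pow_eq_zero h)
      · exact h3 h

open MvPolynomial in
/-- The inequality of Gurvits. -/
lemma sch_gurvits (d : ℕ) (hd : 1 ≤ d) : ∀ (k : ℕ) (p : MvPolynomial (Fin k) ℂ) (C : ℝ),
    0 < C → p.IsHomogeneous k → (∀ i, p.degreeOf i ≤ d) →
    (∀ z : Fin k → ℂ, (∀ i, 0 < (z i).re) → eval z p ≠ 0) →
    (∀ x : Fin k → ℝ, (∀ i, 0 < x i) → C * ∏ i, x i ≤ ‖eval (fun i => (x i : ℂ)) p‖) →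
    ((((d : ℝ) - 1) / d) ^ (d - 1)) ^ k * C ≤
      ‖p.coeff (Finsupp.equivFunOnFinite.symm (fun _ => 1))‖ := by
  intro k
  induction k with
  | zero =>
    intro p C hC hp hdeg hst hcap
    have := hcap (fun _ => 1) (by simp)
    simp only [Finset.univ_eq_empty, Finset.prod_empty, mul_one] at this
    rw [pow_zero, one_mul]
    refine this.trans (le_of_eq ?_)
    rw [MvPolynomial.eq_C_of_isEmpty p, eval_C, coeff_C]
    rw [if_pos (Subsingleton.elim _ _)]
  | succ k ih =>
    intro p C hC hp hdeg hst hcap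
    set q := (finSuccEquiv ℂ k p).coeff 1 with hq
    have hscale : ∀ (c : ℂ) (z : Fin (k + 1) → ℂ), (∀ i, 0 < (c * z i).re) → eval z p ≠ 0 := by
      intro c z h h0
      have := sch_hom p hp c z
      rw [h0, mul_zero] at this
      exact hst _ h this
    have hQ : ∀ (z : Fin k → ℂ) (t : ℂ), Polynomial.eval t
        (Polynomial.map (eval z) (finSuccEquiv ℂ k p)) = eval (Fin.cons t z) p :=
      fun z t => (eval_eq_eval_mv_eval' z t p).symm
    have hq1 : ∀ z : Fin k → ℂ,
        (Polynomial.map (eval z) (finSuccEquiv ℂ k p)).coeff 1 = eval z q :=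
      fun z => by rw [Polynomial.coeff_map]
    have hd' : (1 : ℝ) ≤ d := by exact_mod_cast hd
    -- the lower bound along rays
    have hray : ∀ z : Fin k → ℂ, (∀ i, 0 < (z i).re) → ∀ t : ℝ, 0 < t →
        (C * ∏ i, (z i).re) * t ≤
          ‖Polynomial.eval (t : ℂ) (Polynomial.map (eval z) (finSuccEquiv ℂ k p))‖ := by
      intro z hz t ht
      rw [hQ]
      have hpos : ∀ i, 0 < ((Fin.cons (t : ℂ) z : Fin (k + 1) → ℂ) i).re := by
        intro i
        refine Fin.cases ?_ (fun j => ?_) i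
        · simpa using ht
        · simpa using hz j
      refine le_trans ?_ (sch_lower p hp hst _ hpos)
      refine le_trans (le_of_eq ?_) (hcap (fun i => ((Fin.cons (t : ℂ) z : Fin (k + 1) → ℂ) i).re)
        hpos)
      rw [Fin.prod_univ_succ]
      simp
      ring
    have hgpos : ∀ z : Fin k → ℂ, (∀ i, 0 < (z i).re) → 0 < C * ∏ i, (z i).re :=
      fun z hz => mul_pos hC (Finset.prod_pos fun i _ => hz i)
    -- stability of `q`
    have hqst : ∀ z : Fin k → ℂ, (∀ i, 0 < (z i).re) → eval z q ≠ 0 := by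
      intro z hz
      rw [← hq1]
      refine sch_ne _ _ (hgpos z hz) ?_ (hray z hz)
      intro t ht
      rw [hQ] at ht
      by_contra! hcon
      obtain ⟨ht0, htre⟩ := hcon
      rcases htre.lt_or_eq with hlt | heq
      · refine hst _ ?_ ht
        intro i
        refine Fin.cases ?_ (fun j => ?_) i
        · simpa using hlt
        · simpa using hz j
      · have hev : ∀ᶠ δ : ℝ in nhds 0, ∀ j, 0 < (z j).re + δ * t.im * (z j).im := by
          rw [Filter.eventually_all]
          intro j
          have hc : Continuous fun δ : ℝ => (z j).re + δ * t.im * (z j).im := by fun_prop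
          exact hc.continuousAt.eventually (lt_mem_nhds (by simpa using hz j))
        obtain ⟨δ, hδ, hδ0⟩ := ((hev.filter_mono
          (nhdsWithin_le_nhds (s := Set.Ioi 0))).and self_mem_nhdsWithin).exists
        have hδ0 : 0 < δ := hδ0
        have him : t.im ≠ 0 := fun h => ht0 (Complex.ext heq.symm h)
        refine hscale (1 - Complex.I * (δ * t.im : ℝ)) _ ?_ ht
        intro i
        refine Fin.cases ?_ (fun j => ?_) i
        · have : 0 < δ * (t.im * t.im) := mul_pos hδ0 (mul_self_pos.2 him)
          simp [← heq]
          linarith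
        · have := hδ j
          simp
          linarith
    -- capacity of `q`
    have hqcap : ∀ x : Fin k → ℝ, (∀ i, 0 < x i) →
        ((((d : ℝ) - 1) / d) ^ (d - 1) * C) * ∏ i, x i ≤ ‖eval (fun i => (x i : ℂ)) q‖ := by
      intro x hx
      have hz : ∀ i, 0 < (((x i : ℂ))).re := by simpa using hx
      rw [← hq1, mul_assoc]
      have h1 := hgpos (fun i => (x i : ℂ)) hz
      have h2 := hray (fun i => (x i : ℂ)) hz
      simp only [Complex.ofReal_re] at h1 h2
      refine sch_univ _ d hd ?_ _ h1 ?_ h2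
      · refine Polynomial.natDegree_map_le.trans ?_
        rw [natDegree_finSuccEquiv]
        exact hdeg 0
      · intro t ht
        rw [hQ] at ht
        by_contra hne
        have hle : -‖t‖ ≤ t.re := by
          have := Complex.abs_re_le_norm t
          exact (abs_le.1 this).1
        have hlt : 0 < t.re + ‖t‖ := by
          have := lt_of_le_of_ne hle (Ne.symm hne)
          linarith
        have htp : 0 < ‖t‖ := by
          rcases (norm_nonneg t).eq_or_lt with h | h
          · have : t = 0 := norm_eq_zero.1 h.symm
            simp [this] at hlt
          · exact h
        refine hscale (((‖t‖ : ℝ) : ℂ) + (starRingEnd ℂ) t) _ ?_ ht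
        intro i
        refine Fin.cases ?_ (fun j => ?_) i
        · have hsq : t.re * t.re + t.im * t.im = ‖t‖ * ‖t‖ := by
            rw [← Complex.normSq_apply, Complex.normSq_eq_norm_sq, sq]
          have := mul_pos htp hlt
          simp
          nlinarith
        · have := mul_pos hlt (hx j)
          simp
          linarith
    have hg : 0 < (((d : ℝ) - 1) / d) ^ (d - 1) := by
      rcases hd.eq_or_lt with h | h
      · subst h; simp
      · have : (1 : ℝ) < d := by exact_mod_cast h
        apply pow_pos
        apply div_pos <;> linarith
    have := ih q _ (mul_pos hg hC) (hp.finSuccEquiv_coeff_isHomogeneous 1 k (by ring))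
      (fun i => (degreeOf_coeff_finSuccEquiv p i 1).trans (hdeg _)) hqst hqcap
    rw [hq, finSuccEquiv_coeff_coeff] at this
    have e : Finsupp.cons 1 (Finsupp.equivFunOnFinite.symm (fun _ : Fin k => 1)) =
        (Finsupp.equivFunOnFinite.symm (fun _ : Fin (k + 1) => 1)) := by
      ext i
      refine Fin.cases ?_ (fun j => ?_) i <;> simp
    rw [e] at this
    rw [pow_succ, mul_assoc]
    exact this

open MvPolynomial in
lemma sch_coeff (n : ℕ) (E : Fin n → Fin n → ℕ) :
    (∏ u, ∑ v, C (E u v : ℂ) * X v : MvPolynomial (Fin n) ℂ).coeff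
      (Finsupp.equivFunOnFinite.symm (fun _ => 1)) =
      ((∑ σ : Equiv.Perm (Fin n), ∏ u, E u (σ u) : ℕ) : ℂ) := by
  classical
  rw [Finset.prod_univ_sum, Fintype.piFinset_univ, coeff_sum]
  have hterm : ∀ f : Fin n → Fin n, (∏ u, C (E u (f u) : ℂ) * X (f u) :
      MvPolynomial (Fin n) ℂ).coeff (Finsupp.equivFunOnFinite.symm (fun _ => 1)) =
      if Function.Bijective f then ((∏ u, E u (f u) : ℕ) : ℂ) else 0 := by
    intro f
    have h1 : (∏ u, C (E u (f u) : ℂ) * X (f u) : MvPolynomial (Fin n) ℂ) =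
        monomial (∑ u, Finsupp.single (f u) 1) ((∏ u, E u (f u) : ℕ) : ℂ) := by
      rw [Nat.cast_prod, monomial_sum_index]
      rw [map_prod, ← Finset.prod_mul_distrib]
      refine Finset.prod_congr rfl fun u _ => ?_
      rfl
    rw [h1, coeff_monomial]
    refine if_congr ?_ rfl rfl
    constructor
    · intro h
      have hsurj : Function.Surjective f := by
        intro v
        by_contra! hv
        have := DFunLike.congr_fun h v
        rw [Finsupp.finsetSum_apply] at this
        rw [Finset.sum_eq_zero (fun u _ => by
          rw [Finsupp.single_apply, if_neg (hv u)])] at this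
        simp at this
      exact Finite.surjective_iff_bijective.1 hsurj
    · intro h
      ext v
      rw [Finsupp.finsetSum_apply]
      rw [h.sum_comp (fun w => (Finsupp.single w 1 : Fin n →₀ ℕ) v)]
      simp [Finsupp.single_apply]
  rw [Finset.sum_congr rfl fun f _ => hterm f, ← Finset.sum_filter, Nat.cast_sum]
  exact Finset.sum_bij (fun p h ↦ Equiv.ofBijective p (Finset.mem_filter.1 h).2)
    (fun _ _ ↦ Finset.mem_univ _) (fun _ _ _ _ h ↦ by injection h)
    (fun b _ ↦ ⟨b, Finset.mem_filter.2 ⟨Finset.mem_univ _, b.bijective⟩,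
      Equiv.coe_fn_injective rfl⟩) fun _ _ ↦ rfl

/-- Schrijver's theorem: a `d`-regular bipartite multigraph with both vertex classes
of size `n` (edge multiplicities `E : Fin n → Fin n → ℕ`, all degrees exactly `d ≥ 1`)
has at least `((d-1)^{d-1}/d^{d-2})ⁿ` perfect matchings, where the number of perfect
matchings (counted with multiplicity) is `Σ_σ Π_u E u (σ u)`. -/
theorem schrijver (n d : ℕ) (hd : 1 ≤ d) (E : Fin n → Fin n → ℕ)
    (hregU : ∀ u : Fin n, ∑ v, E u v = d)
    (hregV : ∀ v : Fin n, ∑ u, E u v = d) :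
    (((d : ℝ) - 1) ^ (d - 1) / (d : ℝ) ^ (d - 2)) ^ n ≤
      ((∑ σ : Equiv.Perm (Fin n), ∏ u, E u (σ u) : ℕ) : ℝ) := by
  have hd' : (0 : ℝ) < d := by exact_mod_cast hd
  have hU : ∀ u, ∑ v, (E u v : ℝ) = d := fun u => by exact_mod_cast hregU u
  have hV : ∀ v, ∑ u, (E u v : ℝ) = d := fun v => by exact_mod_cast hregV v
  have hev : ∀ z : Fin n → ℂ, MvPolynomial.eval z
      (∏ u, ∑ v, MvPolynomial.C (E u v : ℂ) * MvPolynomial.X v : MvPolynomial (Fin n) ℂ) =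
      ∏ u, ∑ v, (E u v : ℂ) * z v := by
    intro z; simp [map_prod, map_sum]
  have := sch_gurvits d hd n
    (∏ u, ∑ v, MvPolynomial.C (E u v : ℂ) * MvPolynomial.X v) ((d : ℝ) ^ n) (by positivity)
    (by
      have := MvPolynomial.IsHomogeneous.prod Finset.univ
        (fun u => (∑ v, MvPolynomial.C (E u v : ℂ) * MvPolynomial.X v : MvPolynomial (Fin n) ℂ))
        (fun _ => 1) (fun u _ => MvPolynomial.IsHomogeneous.sum _ _ _
          (fun v _ => MvPolynomial.isHomogeneous_C_mul_X _ _))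
      simpa using this)
    (by
      intro v
      refine (MvPolynomial.degreeOf_prod_le _ _ _).trans ?_
      rw [← hregV v]
      refine Finset.sum_le_sum fun u _ => ?_
      refine (MvPolynomial.degreeOf_sum_le _ _ _).trans ?_
      refine Finset.sup_le fun w _ => ?_
      by_cases hw : v = w
      · subst hw
        by_cases h0 : E u v = 0
        · simp [h0]
        · refine (MvPolynomial.degreeOf_C_mul_le _ _ _).trans ?_
          rw [MvPolynomial.degreeOf_X_self]
          omega
      · refine (MvPolynomial.degreeOf_C_mul_le _ _ _).trans ?_
        rw [MvPolynomial.degreeOf_X_of_ne hw]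
        omega)
    (by
      intro z hz
      rw [hev]
      refine Finset.prod_ne_zero_iff.2 fun u _ h0 => ?_
      have h1 := congrArg Complex.re h0
      simp only [Complex.re_sum, Complex.mul_re, Complex.natCast_re,
        Complex.natCast_im, zero_mul, sub_zero, Complex.zero_re] at h1
      rw [Finset.sum_eq_zero_iff_of_nonneg
        (fun v _ => mul_nonneg (Nat.cast_nonneg _) (hz v).le)] at h1
      have h2 : ∑ v, (E u v : ℝ) = 0 := Finset.sum_eq_zero fun v hv => by
        rcases mul_eq_zero.1 (h1 v hv) with h | h
        · exact h
        · exact absurd h (hz v).ne'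
      rw [hU] at h2
      exact hd'.ne' h2)
    (by
      intro x hx
      rw [hev]
      have e1 : (∏ u, ∑ v, (E u v : ℂ) * (x v : ℂ)) =
          ((∏ u, ∑ v, (E u v : ℝ) * x v : ℝ) : ℂ) := by push_cast; rfl
      rw [e1, Complex.norm_real, Real.norm_eq_abs]
      refine le_trans ?_ (le_abs_self _)
      have hrow : ∀ u, (d : ℝ) * ∏ v, x v ^ ((E u v : ℝ) / d) ≤ ∑ v, (E u v : ℝ) * x v := by
        intro u
        have := Real.geom_mean_le_arith_mean_weighted Finset.univ
          (fun v => (E u v : ℝ) / d) x (fun v _ => by positivity)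
          (by rw [← Finset.sum_div, hU, div_self hd'.ne']) (fun v _ => (hx v).le)
        calc _ ≤ (d : ℝ) * ∑ v, (E u v : ℝ) / d * x v := by gcongr
          _ = _ := by
            rw [Finset.mul_sum]
            refine Finset.sum_congr rfl fun v _ => ?_
            field_simp
      calc (d : ℝ) ^ n * ∏ v, x v = ∏ u : Fin n, ((d : ℝ) * ∏ v, x v ^ ((E u v : ℝ) / d)) := by
            rw [Finset.prod_mul_distrib, Finset.prod_comm]
            congr 1
            · simp
            · refine Finset.prod_congr rfl fun v _ => ?_
              rw [← Real.rpow_sum_of_pos (hx v), ← Finset.sum_div, hV, div_self hd'.ne',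
                Real.rpow_one]
        _ ≤ _ := by
            refine Finset.prod_le_prod (fun u _ => ?_) (fun u _ => hrow u)
            refine mul_nonneg hd'.le (Finset.prod_nonneg fun v _ => ?_)
            exact Real.rpow_nonneg (hx v).le _)
  rw [sch_coeff, Complex.norm_natCast, ← mul_pow] at this
  refine le_trans (le_of_eq ?_) this
  congr 1
  rcases hd.eq_or_lt with h | h
  · subst h; simp
  · obtain ⟨e, rfl⟩ : ∃ e, d = e + 2 := ⟨d - 2, by omega⟩
    rw [div_pow, show e + 2 - 1 = e + 1 from rfl, show e + 2 - 2 = e from rfl,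
      pow_succ ((e + 2 : ℕ) : ℝ) e]
    field_simp
end
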